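/- Let t ∈ ℝ. Then there exists r > 0 such that for every real z with 0 < |z| ≤ r, the number z/(e^z − 1) is positive and (z/(e^z − 1))^t = Σ_{n=0}^∞ (z^n/n!) · Σ_{k=0}^n C(−t,k)·C(n+t, n−k)·S(n+k,k)/C(n+k,n), the series converging absolutely, where S(n+k,k) is the Stirling number of the second kind and for real s, C(s,k) = s(s−1)⋯(s−k+1)/k!. -/

import Mathlib

open Real Finset

/-- Generalized binomial coefficient `C(s, k) = s(s-1)⋯(s-k+1)/k!` for real `s`. -/
noncomputable def genBinom (s : ℝ) (k : ℕ) : ℝ :=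
  (∏ i ∈ Finset.range k, (s - (i : ℝ))) / (Nat.factorial k : ℝ)

/-- Stirling numbers of the second kind (as real numbers):
`S(n,m) = (1/m!) ∑_{k=0}^m C(m,k) (−1)^{m−k} k^n`. -/
noncomputable def stirling2 (n m : ℕ) : ℝ :=
  (1 / (Nat.factorial m : ℝ)) *
    ∑ k ∈ Finset.range (m + 1),
      (Nat.choose m k : ℝ) * (-1 : ℝ) ^ (m - k) * (k : ℝ) ^ n

/-- The power series `(e^X - 1) / X - 1 = ∑ m ≥ 1, X ^ m / (m + 1)!`. -/
noncomputable def expQuotTail : PowerSeries ℝ :=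
  PowerSeries.mk fun m => if m = 0 then 0 else 1 / ((m + 1).factorial : ℝ)

lemma genBinom_eq_ring_choose (s : ℝ) (k : ℕ) : genBinom s k = Ring.choose s k := by
  rw [Ring.choose_eq_smul, ← Polynomial.aeval_eq_smeval, Polynomial.aeval_def,
    ← Polynomial.eval_map, descPochhammer_map, descPochhammer_eval_eq_prod_range, genBinom,
    smul_eq_mul, div_eq_inv_mul]

/-- Lagrange interpolation at `0, …, n`, applied to the polynomial `s ↦ C(s, j)` with `j ≤ n`. -/
lemma sum_choose_mul_choose_mul_natChoose (s : ℝ) {j n : ℕ} (hj : j ≤ n) :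
    ∑ k ∈ Finset.range (n + 1), Ring.choose s k * Ring.choose ((n : ℝ) - s) (n - k) *
      (k.choose j : ℝ) = Ring.choose s j := by
  obtain ⟨m, rfl⟩ := Nat.exists_eq_add_of_le hj
  rw [add_assoc, Finset.sum_range_add, Finset.sum_eq_zero, zero_add]
  · have vandermonde := Ring.add_choose_eq (r := s - j) (s := ((j + m : ℕ) : ℝ) - s) m
      (Commute.all _ _)
    have hsum : s - j + (((j + m : ℕ) : ℝ) - s) = (m : ℕ) := by push_cast; ring
    rw [hsum, Ring.choose_natCast, Nat.choose_self, Nat.cast_one,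
      Finset.Nat.sum_antidiagonal_eq_sum_range_succ_mk] at vandermonde
    rw [← mul_one (Ring.choose s j), vandermonde, Finset.mul_sum]
    refine Finset.sum_congr rfl fun i _ => ?_
    have h := Ring.choose_smul_choose s (Nat.le_add_right j i)
    rw [nsmul_eq_mul, Nat.add_sub_cancel_left] at h
    rw [Nat.add_sub_add_left, ← mul_assoc, ← h]
    ring
  · intro k hk
    rw [Nat.choose_eq_zero_of_lt (Finset.mem_range.mp hk)]
    simp

lemma coeff_exp_sub_one_pow (n k : ℕ) :
    PowerSeries.coeff n ((PowerSeries.exp ℝ - 1) ^ k) =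
      (k.factorial : ℝ) * stirling2 n k / (n.factorial : ℝ) := by
  rw [sub_eq_add_neg, add_pow, map_sum, stirling2, ← mul_assoc, mul_one_div_cancel (by positivity),
    one_mul, Finset.sum_div]
  refine Finset.sum_congr rfl fun i _ => ?_
  rw [PowerSeries.exp_pow_eq_rescale_exp]
  have h : ((-1 : PowerSeries ℝ) ^ (k - i) * (k.choose i : PowerSeries ℝ)) =
      PowerSeries.C ((-1 : ℝ) ^ (k - i) * (k.choose i : ℝ)) := by simp
  rw [mul_assoc, h, PowerSeries.coeff_mul_C, PowerSeries.coeff_rescale, PowerSeries.coeff_exp]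
  simp
  ring

lemma X_mul_one_add_expQuotTail :
    PowerSeries.X * (1 + expQuotTail) = PowerSeries.exp ℝ - 1 := by
  ext n
  rcases n with _ | n
  · simp
  · rw [PowerSeries.coeff_succ_X_mul]
    rcases n with _ | n <;> simp [expQuotTail, PowerSeries.coeff_exp, PowerSeries.coeff_one]

lemma coeff_one_add_expQuotTail_pow (n k : ℕ) :
    PowerSeries.coeff n ((1 + expQuotTail) ^ k) =
      stirling2 (n + k) k / ((n + k).choose n : ℝ) / (n.factorial : ℝ) := by
  rw [← PowerSeries.coeff_X_pow_mul _ k n, ← mul_pow, X_mul_one_add_expQuotTail,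
    coeff_exp_sub_one_pow, Nat.cast_add_choose]
  field_simp

lemma coeff_expQuotTail_pow_eq_zero {n j : ℕ} (h : n < j) :
    PowerSeries.coeff n (expQuotTail ^ j) = 0 := by
  refine PowerSeries.X_pow_dvd_iff.mp (pow_dvd_pow_of_dvd ?_ j) n h
  rw [PowerSeries.X_dvd_iff]
  simp [expQuotTail]

lemma coeff_expQuotTail_pow_nonneg (j n : ℕ) :
    0 ≤ PowerSeries.coeff n (expQuotTail ^ j) := by
  induction j generalizing n with
  | zero => rw [pow_zero, PowerSeries.coeff_one]; split_ifs <;> simp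
  | succ j ih =>
    rw [pow_succ, PowerSeries.coeff_mul]
    refine Finset.sum_nonneg fun p _ => mul_nonneg (ih _) ?_
    rw [expQuotTail, PowerSeries.coeff_mk]
    split_ifs <;> positivity

lemma sum_natChoose_mul_coeff (n k : ℕ) :
    ∑ j ∈ Finset.range (n + 1), (k.choose j : ℝ) * PowerSeries.coeff n (expQuotTail ^ j) =
      PowerSeries.coeff n ((1 + expQuotTail) ^ k) := by
  have h : ∀ j, PowerSeries.coeff n (expQuotTail ^ j * (k.choose j : PowerSeries ℝ)) =
      (k.choose j : ℝ) * PowerSeries.coeff n (expQuotTail ^ j) := fun j => by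
    rw [mul_comm, ← map_natCast (PowerSeries.C (R := ℝ)), PowerSeries.coeff_C_mul]
  rw [add_comm (1 : PowerSeries ℝ), add_pow, map_sum]
  simp only [one_pow, mul_one, h]
  trans ∑ j ∈ Finset.range (n + k + 1),
    (k.choose j : ℝ) * PowerSeries.coeff n (expQuotTail ^ j)
  · refine Finset.sum_subset (fun j => by simp; lia) fun j _ hj => ?_
    rw [coeff_expQuotTail_pow_eq_zero (show n < j by simp at hj; lia), mul_zero]
  · refine (Finset.sum_subset (fun j => by simp; lia) fun j _ hj => ?_).symm
    rw [Nat.choose_eq_zero_of_lt (by simpa using hj), Nat.cast_zero, zero_mul]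

lemma sum_genBinom_mul_stirling2_eq (t : ℝ) (n : ℕ) :
    (∑ k ∈ Finset.range (n + 1), genBinom (-t) k * genBinom ((n : ℝ) + t) (n - k) *
      (stirling2 (n + k) k / ((n + k).choose n : ℝ))) / (n.factorial : ℝ) =
    ∑ j ∈ Finset.range (n + 1), Ring.choose (-t) j *
      PowerSeries.coeff n (expQuotTail ^ j) := by
  have hn : (n : ℝ) + t = n - -t := by ring
  simp only [genBinom_eq_ring_choose, Finset.sum_div, mul_div_assoc (_ * _),
    ← coeff_one_add_expQuotTail_pow, ← sum_natChoose_mul_coeff, Finset.mul_sum, hn]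
  rw [Finset.sum_comm]
  refine Finset.sum_congr rfl fun j hj => ?_
  rw [← sum_choose_mul_choose_mul_natChoose (-t) (Nat.lt_succ_iff.mp (Finset.mem_range.mp hj)),
    Finset.sum_mul]
  exact Finset.sum_congr rfl fun k _ => by ring

lemma hasSum_coeff_expQuotTail {z : ℝ} (hz : z ≠ 0) :
    HasSum (fun n => PowerSeries.coeff n expQuotTail * z ^ n) ((Real.exp z - 1) / z - 1) := by
  have h := NormedSpace.expSeries_div_hasSum_exp z
  rw [← Real.exp_eq_exp_ℝ, ← hasSum_nat_add_iff' 2] at h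
  rw [← hasSum_nat_add_iff' 1]
  convert h.div_const z using 1
  · rfl
  · funext n
    rw [expQuotTail, PowerSeries.coeff_mk, if_neg n.succ_ne_zero]
    field_simp
    ring
  · simp [expQuotTail, Finset.sum_range_succ]
    field_simp
    ring

lemma hasSum_coeff_pow {A : PowerSeries ℝ} {z a : ℝ}
    (h : HasSum (fun n => PowerSeries.coeff n A * z ^ n) a) (j : ℕ) :
    HasSum (fun n => PowerSeries.coeff n (A ^ j) * z ^ n) (a ^ j) := by
  induction j with
  | zero =>
    convert hasSum_ite_eq (0 : ℕ) (1 : ℝ) using 2 with n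
    · rw [pow_zero, PowerSeries.coeff_one]
      split_ifs with hn <;> simp [hn]
    · simp
  | succ j ih =>
    have hterm : ∀ n, PowerSeries.coeff n (A ^ (j + 1)) * z ^ n =
        ∑ p ∈ Finset.HasAntidiagonal.antidiagonal n, (PowerSeries.coeff p.1 (A ^ j) * z ^ p.1) *
          (PowerSeries.coeff p.2 A * z ^ p.2) := fun n => by
      rw [pow_succ, PowerSeries.coeff_mul, Finset.sum_mul]
      refine Finset.sum_congr rfl fun p hp => ?_
      rw [← Finset.HasAntidiagonal.mem_antidiagonal.mp hp, pow_add]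
      ring
    simp only [hterm]
    rw [pow_succ, ← ih.tsum_eq, ← h.tsum_eq,
      tsum_mul_tsum_eq_tsum_sum_antidiagonal_of_summable_norm ih.summable.norm h.summable.norm]
    exact (summable_norm_sum_mul_antidiagonal_of_summable_norm ih.summable.norm
      h.summable.norm).of_norm.hasSum

lemma hasSum_choose_mul_pow (s : ℝ) {y : ℝ} (hy : |y| < 1) :
    HasSum (fun j => Ring.choose s j * y ^ j) ((1 + y) ^ s) := by
  have h := (Real.one_add_rpow_hasFPowerSeriesOnBall_zero (a := s)).hasSum (y := y) (by
    simpa [Metric.mem_eball, edist_dist, ENNReal.ofReal_lt_one] using hy)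
  simpa only [binomialSeries_apply, List.ofFn_const, List.prod_replicate, zero_add, smul_eq_mul]
    using h

lemma abs_exp_sub_one_div_sub_one_lt_one {z : ℝ} (hz : z ≠ 0) (hz1 : |z| ≤ 1 / 2) :
    |(Real.exp z - 1) / z - 1| < 1 := by
  have h := Real.abs_exp_sub_one_sub_id_le (x := z) (by linarith)
  have hpos : 0 < |z| := abs_pos.mpr hz
  have heq : (Real.exp z - 1) / z - 1 = (Real.exp z - 1 - z) / z := by field_simp
  rw [heq, abs_div, div_lt_one hpos]
  rw [← sq_abs] at h
  nlinarith

lemma hasSum_one_add_rpow_expQuotTail (s : ℝ) {z : ℝ} (hz : z ≠ 0) (hz1 : |z| ≤ 1 / 2) :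
    HasSum (fun n => (∑ j ∈ Finset.range (n + 1), Ring.choose s j *
      PowerSeries.coeff n (expQuotTail ^ j)) * z ^ n) (((Real.exp z - 1) / z) ^ s) := by
  set f : ℕ × ℕ → ℝ := fun p =>
    Ring.choose s p.1 * (PowerSeries.coeff p.2 (expQuotTail ^ p.1) * z ^ p.2) with hf
  have hrow : ∀ j, HasSum (fun n => f (j, n))
      (Ring.choose s j * ((Real.exp z - 1) / z - 1) ^ j) := fun j =>
    (hasSum_coeff_pow (hasSum_coeff_expQuotTail hz) j).mul_left _
  have habs : |(|z|)| ≤ 1 / 2 := by rwa [abs_abs]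
  have hz' : |z| ≠ 0 := abs_ne_zero.mpr hz
  set y : ℝ := (Real.exp |z| - 1) / |z| - 1 with hy
  have hrow_abs : ∀ j, HasSum (fun n => |f (j, n)|) (|Ring.choose s j| * y ^ j) := fun j => by
    refine ((hasSum_coeff_pow (hasSum_coeff_expQuotTail hz') j).mul_left
      |Ring.choose s j|).congr_fun fun n => ?_
    simp only [hf, abs_mul, abs_pow, abs_of_nonneg (coeff_expQuotTail_pow_nonneg j n)]
  have hy0 : 0 ≤ y := by
    rw [hy, sub_nonneg, one_le_div (by positivity)]
    linarith [Real.add_one_le_exp |z|]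
  have hsummable : Summable f := by
    rw [← summable_abs_iff, summable_prod_of_nonneg fun _ => abs_nonneg _]
    refine ⟨fun j => (hrow_abs j).summable, ?_⟩
    simp only [(hrow_abs _).tsum_eq]
    have h := (hasSum_choose_mul_pow s
      (abs_exp_sub_one_div_sub_one_lt_one hz' habs)).summable.abs
    simpa only [abs_mul, abs_pow, ← hy, abs_of_nonneg hy0] using h
  have hval : ∑' p, f p = ((Real.exp z - 1) / z) ^ s := by
    rw [(hsummable.hasSum.prod_fiberwise hrow).unique
      (hasSum_choose_mul_pow s (abs_exp_sub_one_div_sub_one_lt_one hz hz1)), add_sub_cancel]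
  rw [← hval, ← (Equiv.prodComm ℕ ℕ).tsum_eq]
  refine ((Equiv.prodComm ℕ ℕ).summable_iff.mpr hsummable).hasSum.prod_fiberwise fun n => ?_
  rw [Finset.sum_mul]
  simp only [mul_assoc]
  refine hasSum_sum_of_ne_finset_zero fun j hj => ?_
  simp [hf, coeff_expQuotTail_pow_eq_zero (show n < j by simpa using hj)]

theorem stmt_14 (t : ℝ) :
    ∃ r > (0 : ℝ), ∀ z : ℝ, 0 < |z| → |z| ≤ r →
      0 < z / (Real.exp z - 1) ∧
      Summable (fun n : ℕ => |z ^ n / (Nat.factorial n : ℝ) *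
        ∑ k ∈ Finset.range (n + 1),
          genBinom (-t) k * genBinom ((n : ℝ) + t) (n - k) *
            (stirling2 (n + k) k / (Nat.choose (n + k) n : ℝ))|) ∧
      (z / (Real.exp z - 1)) ^ t =
        ∑' n : ℕ, z ^ n / (Nat.factorial n : ℝ) *
          ∑ k ∈ Finset.range (n + 1),
            genBinom (-t) k * genBinom ((n : ℝ) + t) (n - k) *
              (stirling2 (n + k) k / (Nat.choose (n + k) n : ℝ)) := by
  refine ⟨1 / 2, by norm_num, fun z hz hz1 => ?_⟩
  have hz0 : z ≠ 0 := abs_pos.mp hz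
  have hpos : 0 < (Real.exp z - 1) / z := by
    linarith [(abs_lt.mp (abs_exp_sub_one_div_sub_one_lt_one hz0 hz1)).1]
  have hsum := hasSum_one_add_rpow_expQuotTail (-t) hz0 hz1
  simp only [← sum_genBinom_mul_stirling2_eq, div_mul_comm _ _ (z ^ _)] at hsum
  rw [Real.rpow_neg hpos.le, ← Real.inv_rpow hpos.le, inv_div] at hsum
  exact ⟨by simpa using inv_pos.mpr hpos, hsum.summable.abs, hsum.tsum_eq.symm⟩
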